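/- Let λ ∈ ℝ and define the entire function K : ℂ → ℂ by K(ζ) := Σ_{k=0}^∞ ((−λ²/4)^k/(k!)²)·ζ^k. Let D, D' ⊆ ℂ be open, S holomorphic on D with S(D) ⊆ D', and let u : ℂ × ℂ → ℂ be holomorphic on D × D' and satisfy ∂²u/∂z∂w + (λ²/4)·u = 0 on D × D'. Let k > 0 and let T be holomorphic on D, and suppose that for all z ∈ D: u(z, S(z)) = 0 and (∂u/∂z)(z, S(z)) − (∂u/∂w)(z, S(z))·S'(z) = −T(z)/(2k). Let z₀ ∈ D, w₀ ∈ D', ζ₀ ∈ D with S(ζ₀) = w₀, and assume the straight segment [ζ₀, z₀] is contained in D. Then u(z₀, w₀) = −(1/(4k)) · ∫_{[ζ₀,z₀]} T(z)·K((z − z₀)·(S(z) − w₀)) dz. -/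

import Mathlib

open Complex

/-- Complex contour integral along the straight segment from `p` to `q`. -/
noncomputable def segIntegral (f : ℂ → ℂ) (p q : ℂ) : ℂ :=
  (q - p) * ∫ t in (0:ℝ)..1, f (p + (t : ℂ) * (q - p))

/-- The entire function `K(ζ) = Σ_{k≥0} ((−λ²/4)^k/(k!)²) ζ^k`, so that
`K((z−z₀)(S(z)−w₀)) = J₀(λ√((z−z₀)(S(z)−w₀)))` is the Riemann function of the
Helmholtz operator. -/
noncomputable def besselKernel (lam : ℝ) (ζ : ℂ) : ℂ :=
  ∑' n : ℕ, ((-(lam : ℂ) ^ 2 / 4) ^ n / ((n.factorial : ℂ)) ^ 2) * ζ ^ n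

open Set Filter Topology MeasureTheory in
theorem aux_diff_partial (Ω : Set (ℂ × ℂ)) (hΩ : IsOpen Ω) (f : ℂ × ℂ → ℂ)
    (hf : DifferentiableOn ℂ f Ω) :
    DifferentiableOn ℂ (fun x => fderiv ℂ f x ((1 : ℂ), (0 : ℂ))) Ω := by
  intro x₀ hx₀
  apply DifferentiableAt.differentiableWithinAt
  set v : ℂ × ℂ := (1, 0) with hv
  have hvn : ‖v‖ = 1 := by simp [hv, Prod.norm_def]
  have hcont : ContinuousAt f x₀ := (hf.differentiableAt (hΩ.mem_nhds hx₀)).continuousAt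
  obtain ⟨ε, hε, hball⟩ : ∃ ε > 0, ∀ x ∈ Metric.ball x₀ ε, x ∈ Ω ∧ dist (f x) (f x₀) < 1 := by
    have h0 : ∀ᶠ x in 𝓝 x₀, x ∈ Ω := hΩ.mem_nhds hx₀
    have h := h0.and
      (hcont.eventually (Metric.ball_mem_nhds (f x₀) one_pos))
    obtain ⟨ε, hε, h⟩ := Metric.eventually_nhds_iff_ball.1 h
    exact ⟨ε, hε, h⟩
  set r := ε / 3 with hr
  have hr0 : 0 < r := by positivity
  have hrε : ε = 3 * r := by rw [hr]; ring
  have hsub : ∀ x ∈ Metric.ball x₀ (3 * r), DifferentiableAt ℂ f x := fun x hx =>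
    hf.differentiableAt (hΩ.mem_nhds (hball x (by rwa [hrε])).1)
  have hbd : ∀ y ∈ Metric.ball x₀ (2 * r), ‖fderiv ℂ f y‖ ≤ 2 / r := by
    intro y hy
    have hs : Metric.ball y r ⊆ Metric.ball x₀ (3 * r) := by
      apply Metric.ball_subset_ball'
      have := Metric.mem_ball.1 hy
      linarith
    refine Complex.norm_fderiv_le_div_of_mapsTo_ball
      (fun x hx => (hsub x (hs hx)).differentiableWithinAt) ?_ hr0
    intro x hx
    have h1 := (hball x (by rw [hrε]; exact hs hx)).2
    have h2 := (hball y (by rw [hrε]; exact hs (Metric.mem_ball_self hr0))).2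
    rw [Metric.mem_closedBall]
    have := dist_triangle_right (f x) (f y) (f x₀)
    linarith
  have hin : ∀ x ∈ Metric.ball x₀ r, ∀ c : ℂ, ‖c‖ ≤ r → x + c • v ∈ Metric.ball x₀ (2 * r) := by
    intro x hx c hc
    rw [Metric.mem_ball, dist_eq_norm] at *
    have : x + c • v - x₀ = (x - x₀) + c • v := by abel
    rw [this]
    have h2 := norm_add_le (x - x₀) (c • v)
    rw [norm_smul, hvn, mul_one] at h2
    linarith
  have h23 : Metric.ball x₀ (2 * r) ⊆ Metric.ball x₀ (3 * r) :=
    Metric.ball_subset_ball (by linarith)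
  set g : ℝ → ℂ := fun θ => deriv (circleMap 0 r) θ * (1 / (circleMap 0 r θ) ^ 2) with hg
  have hc0 : ∀ θ, circleMap 0 r θ ≠ 0 := fun θ => circleMap_ne_center hr0.ne'
  have hcn : ∀ θ, ‖circleMap 0 r θ‖ ≤ r := fun θ => by simp [abs_of_pos hr0]
  have hgc : Continuous g := by
    simp only [hg, deriv_circleMap]
    refine Continuous.mul ((continuous_circleMap _ _).mul continuous_const) ?_
    exact continuous_const.div ((continuous_circleMap _ _).pow 2) (fun θ => pow_ne_zero 2 (hc0 θ))
  set F : ℂ × ℂ → ℝ → ℂ := fun x θ => g θ * f (x + circleMap 0 r θ • v) with hF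
  have hFc : ∀ x ∈ Metric.ball x₀ r, Continuous (F x) := by
    intro x hx
    refine hgc.mul (continuous_iff_continuousAt.2 fun θ => ?_)
    refine ContinuousAt.comp (f := fun θ : ℝ => x + circleMap 0 r θ • v) (g := f) ?_ ?_
    · exact (hsub _ (h23 (hin x hx _ (hcn θ)))).continuousAt
    · exact (continuous_const.add ((continuous_circleMap _ _).smul continuous_const)).continuousAt
  have hformula : ∀ x ∈ Metric.ball x₀ r,
      fderiv ℂ f x v = (2 * Real.pi * I)⁻¹ * ∫ θ in (0:ℝ)..2 * Real.pi, F x θ := by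
    intro x hx
    have hd : DifferentiableOn ℂ (fun t : ℂ => f (x + t • v)) (Metric.closedBall 0 r) := by
      intro t ht
      have h1 := hsub _ (h23 (hin x hx t (by simpa using ht)))
      apply DifferentiableAt.differentiableWithinAt
      exact h1.comp (f := fun t : ℂ => x + t • v) t (by fun_prop)
    have h := DifferentiableOn.deriv_eq_smul_circleIntegral hr0 hd
    have hder : deriv (fun t : ℂ => f (x + t • v)) 0 = fderiv ℂ f x v := by
      have h1 : HasFDerivAt f (fderiv ℂ f x) (x + (0:ℂ) • v) := by
        simpa using (hsub x (Metric.ball_subset_ball (by linarith) hx)).hasFDerivAt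
      have h2 : HasDerivAt (fun t : ℂ => x + t • v) ((1:ℂ) • v) 0 :=
        ((hasDerivAt_id (0:ℂ)).smul_const v).const_add x
      have := h1.comp_hasDerivAt (0:ℂ) h2
      have h3 := this.deriv
      rw [one_smul] at h3
      exact h3
    rw [hder, circleIntegral] at h
    have hne : (2 * Real.pi * I : ℂ) ≠ 0 := Complex.two_pi_I_ne_zero
    rw [eq_inv_mul_iff_mul_eq₀ hne, ← smul_eq_mul, ← h]
    congr 1
    ext θ
    simp [hF, hg, mul_assoc]
  have hball_nhds : Metric.ball x₀ r ∈ 𝓝 x₀ := Metric.ball_mem_nhds _ hr0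
  have key := intervalIntegral.hasFDerivAt_integral_of_dominated_of_fderiv_le (𝕜 := ℂ)
    (μ := volume) (a := 0) (b := 2 * Real.pi) (F := F) (x₀ := x₀) (s := Metric.ball x₀ r)
    (F' := fun x θ => g θ • fderiv ℂ f (x + circleMap 0 r θ • v))
    (bound := fun θ => ‖g θ‖ * (2 / r)) hball_nhds
    (by filter_upwards [hball_nhds] with x hx using (hFc x hx).aestronglyMeasurable)
    ((hFc x₀ (Metric.mem_ball_self hr0)).intervalIntegrable _ _)
    (by
      refine hgc.aestronglyMeasurable.smul ?_
      have : Measurable (fun θ : ℝ => x₀ + circleMap 0 r θ • v) :=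
        (continuous_const.add ((continuous_circleMap _ _).smul continuous_const)).measurable
      exact ((measurable_fderiv ℂ f).comp this).aestronglyMeasurable)
    (by
      refine Eventually.of_forall fun θ _ x hx => ?_
      rw [norm_smul]
      exact mul_le_mul_of_nonneg_left (hbd _ (hin x hx _ (hcn θ))) (norm_nonneg _))
    ((hgc.norm.mul continuous_const).intervalIntegrable _ _)
    (by
      refine Eventually.of_forall fun θ _ x hx => ?_
      have h1 := (hsub _ (h23 (hin x hx _ (hcn θ)))).hasFDerivAt
      have h2 : HasFDerivAt (fun x : ℂ × ℂ => x + circleMap 0 r θ • v)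
          (ContinuousLinearMap.id ℂ (ℂ × ℂ)) x := (hasFDerivAt_id x).add_const _
      have h3 := (h1.comp x h2).const_mul (g θ)
      simpa using h3)
  have := (key.differentiableAt.const_mul (2 * Real.pi * I : ℂ)⁻¹)
  refine this.congr_of_eventuallyEq ?_
  filter_upwards [hball_nhds] with x hx using hformula x hx

theorem aux_primitive (V : Set ℂ) (hV : IsOpen V) (hVc : Convex ℝ V) (a b : ℂ × ℂ → ℂ)
    (ha : DifferentiableOn ℂ a (V ×ˢ V)) (hb : DifferentiableOn ℂ b (V ×ˢ V))
    (hab : ∀ z ∈ V, ∀ ζ ∈ V, deriv (fun ζ' => a (z, ζ')) ζ = deriv (fun z' => b (z', ζ)) z) :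
    ∃ P : ℂ × ℂ → ℂ, ∀ x ∈ V ×ˢ V, HasFDerivAt P
      (a x • ContinuousLinearMap.fst ℂ ℂ ℂ + b x • ContinuousLinearMap.snd ℂ ℂ ℂ) x := by
  have ho : IsOpen (V ×ˢ V) := hV.prod hV
  have hω : ∀ x ∈ V ×ˢ V, HasFDerivAt (fun x => a x • ContinuousLinearMap.fst ℂ ℂ ℂ
      + b x • ContinuousLinearMap.snd ℂ ℂ ℂ)
      ((fderiv ℂ a x).smulRight (ContinuousLinearMap.fst ℂ ℂ ℂ)
        + (fderiv ℂ b x).smulRight (ContinuousLinearMap.snd ℂ ℂ ℂ)) x := by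
    intro x hx
    exact ((ha.differentiableAt (ho.mem_nhds hx)).hasFDerivAt.smul_const
        (ContinuousLinearMap.fst ℂ ℂ ℂ)).add
      ((hb.differentiableAt (ho.mem_nhds hx)).hasFDerivAt.smul_const
        (ContinuousLinearMap.snd ℂ ℂ ℂ))
  refine (hVc.prod hVc).exists_forall_hasFDerivAt_of_fderiv_symmetric ho
    (fun x hx => ((hω x hx).restrictScalars ℝ).differentiableAt.differentiableWithinAt) ?_
  rintro ⟨z, ζ⟩ hx ⟨x1, x2⟩ ⟨y1, y2⟩
  rw [((hω _ hx).restrictScalars ℝ).fderiv]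
  have h1 : deriv (fun ζ' => a (z, ζ')) ζ = fderiv ℂ a (z, ζ) (0, 1) :=
    ((ha.differentiableAt (ho.mem_nhds hx)).hasFDerivAt.comp_hasDerivAt ζ
      ((hasDerivAt_const ζ z).prodMk (hasDerivAt_id ζ))).deriv
  have h2 : deriv (fun z' => b (z', ζ)) z = fderiv ℂ b (z, ζ) (1, 0) :=
    ((hb.differentiableAt (ho.mem_nhds hx)).hasFDerivAt.comp_hasDerivAt z
      ((hasDerivAt_id z).prodMk (hasDerivAt_const z ζ))).deriv
  have h3 := hab z hx.1 ζ hx.2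
  rw [h1, h2] at h3
  have hdec : ∀ (L : ℂ × ℂ →L[ℂ] ℂ) (p q : ℂ), L (p, q) = p * L (1, 0) + q * L (0, 1) := by
    intro L p q
    have : ((p, q) : ℂ × ℂ) = p • ((1:ℂ), (0:ℂ)) + q • ((0:ℂ), (1:ℂ)) := by simp
    rw [this, map_add, map_smul, map_smul, smul_eq_mul, smul_eq_mul]
  simp only [ContinuousLinearMap.coe_restrictScalars', _root_.add_apply,
    ContinuousLinearMap.smulRight_apply, _root_.smul_apply,
    ContinuousLinearMap.coe_fst', ContinuousLinearMap.coe_snd', smul_eq_mul]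
  rw [hdec (fderiv ℂ a (z, ζ)) x1 x2, hdec (fderiv ℂ a (z, ζ)) y1 y2,
    hdec (fderiv ℂ b (z, ζ)) x1 x2, hdec (fderiv ℂ b (z, ζ)) y1 y2, h3]
  ring

theorem aux_series (c : ℕ → ℂ) (M : ℝ) (hM : 0 ≤ M)
    (hc : ∀ n, ‖c n‖ ≤ M ^ n / n.factorial) :
    Differentiable ℂ (fun ζ => ∑' n, c n * ζ ^ n) ∧
    ∀ z, HasSum (fun n => c n * (n * z ^ (n - 1))) (deriv (fun ζ => ∑' n, c n * ζ ^ n) z) := by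
  have hb : ∀ z : ℂ, ∀ (n : ℕ) (w : ℂ), w ∈ Metric.ball (0:ℂ) (‖z‖ + 1) →
      ‖c n * w ^ n‖ ≤ (M * (‖z‖ + 1)) ^ n / n.factorial := by
    intro z n w hw
    rw [norm_mul, norm_pow, mul_pow, mul_div_right_comm]
    have : ‖w‖ ≤ ‖z‖ + 1 := by simpa using (Metric.mem_ball.1 hw).le
    gcongr
    exact hc n
  have hz : ∀ z : ℂ, z ∈ Metric.ball (0:ℂ) (‖z‖ + 1) := fun z => by simp
  have hd : ∀ z : ℂ, ∀ n : ℕ, DifferentiableOn ℂ (fun w => c n * w ^ n)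
      (Metric.ball (0:ℂ) (‖z‖ + 1)) := fun z n => by fun_prop
  refine ⟨fun z => ?_, fun z => ?_⟩
  · exact (Complex.differentiableOn_tsum_of_summable_norm (Real.summable_pow_div_factorial _)
      (hd z) Metric.isOpen_ball (hb z)).differentiableAt (Metric.isOpen_ball.mem_nhds (hz z))
  · have := Complex.hasSum_deriv_of_summable_norm (Real.summable_pow_div_factorial _)
      (hd z) Metric.isOpen_ball (hb z) (hz z)
    simpa using this

theorem aux_bessel (lam : ℝ) : Differentiable ℂ (besselKernel lam) ∧ besselKernel lam 0 = 1 ∧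
    ∀ z, deriv (besselKernel lam) z + z * deriv (deriv (besselKernel lam)) z
      = -((lam : ℂ) ^ 2 / 4) * besselKernel lam z := by
  set q : ℂ := -(lam : ℂ) ^ 2 / 4 with hq
  set c : ℕ → ℂ := fun n => q ^ n / ((n.factorial : ℂ)) ^ 2 with hcdef
  have hK : besselKernel lam = fun ζ => ∑' n, c n * ζ ^ n := rfl
  have hfac : ∀ n : ℕ, (1:ℝ) ≤ n.factorial := fun n => by
    exact_mod_cast Nat.one_le_iff_ne_zero.2 (Nat.factorial_ne_zero n)
  have hn : ∀ n, ‖c n‖ = ‖q‖ ^ n / (n.factorial : ℝ) ^ 2 := fun n => by simp [hcdef]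
  have hc : ∀ n, ‖c n‖ ≤ ‖q‖ ^ n / n.factorial := by
    intro n
    rw [hn]
    have := hfac n
    gcongr
    nlinarith
  have hc2 : ∀ n : ℕ, ‖(n : ℂ) * c n‖ ≤ ‖q‖ ^ n / n.factorial := by
    intro n
    rw [norm_mul, hn, Complex.norm_natCast]
    have h1 := hfac n
    have h2 : (n : ℝ) ≤ n.factorial := by exact_mod_cast Nat.self_le_factorial n
    have h3 : 0 ≤ ‖q‖ ^ n := by positivity
    rw [← mul_div_assoc, div_le_div_iff₀ (by positivity) (by positivity)]
    calc n * ‖q‖ ^ n * n.factorial ≤ n.factorial * ‖q‖ ^ n * n.factorial := by gcongr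
      _ = _ := by ring
  obtain ⟨d1, s1⟩ := aux_series c ‖q‖ (norm_nonneg _) hc
  obtain ⟨d2, s2⟩ := aux_series (fun n => n * c n) ‖q‖ (norm_nonneg _) hc2
  rw [← hK] at d1 s1
  have hzK : (fun ζ => ∑' n : ℕ, (n * c n) * ζ ^ n) = fun ζ => ζ * deriv (besselKernel lam) ζ := by
    ext ζ
    rw [← ((s1 ζ).mul_left ζ).tsum_eq]
    congr 1
    ext n
    rcases n with _ | n
    · simp
    · simp only [Nat.add_sub_cancel]; ring
  have dK' : Differentiable ℂ (deriv (besselKernel lam)) := by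
    have : ContDiff ℂ 2 (besselKernel lam) := d1.contDiff
    exact (this.iterate_deriv' 1 1).differentiable (by norm_num)
  refine ⟨d1, ?_, fun z => ?_⟩
  · rw [hK]
    simp only
    rw [tsum_eq_single 0]
    · simp [hcdef]
    · intro n hn; simp [hn]
  · have hs := s2 z
    rw [hzK] at hs
    have hder : deriv (fun ζ => ζ * deriv (besselKernel lam) ζ) z
        = deriv (besselKernel lam) z + z * deriv (deriv (besselKernel lam)) z := by
      have := (hasDerivAt_id z).mul (dK' z).hasDerivAt
      have h3 := this.deriv
      simp only [id, one_mul] at h3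
      exact h3
    rw [← hder, ← hs.tsum_eq, hs.summable.tsum_eq_zero_add]
    have hqq : -((lam : ℂ) ^ 2 / 4) = q := by rw [hq]; ring
    rw [hqq, hK]
    simp only [← tsum_mul_left]
    simp only [Nat.cast_zero, zero_mul, zero_add, mul_zero]
    congr 1
    ext n
    simp only [hcdef, Nat.add_sub_cancel, Nat.factorial_succ]
    have h1 : (n.factorial : ℂ) ≠ 0 := by exact_mod_cast Nat.factorial_ne_zero n
    have h2 : ((n : ℂ) + 1) ≠ 0 := by exact_mod_cast Nat.succ_ne_zero n
    push_cast
    field_simp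
    ring

/-- Representation of the solution to the elliptic growth problem governed by
the Helmholtz equation: `u` solves the complexified Helmholtz equation
`∂²u/∂z∂w + (λ²/4)u = 0` near the interface `{w = S(z)}`, vanishes on the
curve, and satisfies `u_z − u_w S' = −T/(2k)` (`T = Ṡ`); then
`u(z₀,w₀) = −(1/(4k)) ∫_{S̃(w₀)}^{z₀} T(z) J₀(λ√((z−z₀)(S(z)−w₀))) dz`. -/
theorem elliptic_growth_helmholtz_representation
    (lam : ℝ) (D D' : Set ℂ) (hD : IsOpen D) (hD' : IsOpen D')
    (S : ℂ → ℂ) (hS : DifferentiableOn ℂ S D) (hSD : S '' D ⊆ D')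
    (u : ℂ × ℂ → ℂ) (hu : DifferentiableOn ℂ u (D ×ˢ D'))
    (hhelm : ∀ z ∈ D, ∀ w ∈ D',
      deriv (fun w' => deriv (fun z' => u (z', w')) z) w
        + ((lam : ℂ) ^ 2 / 4) * u (z, w) = 0)
    (k : ℝ) (hk : 0 < k) (T : ℂ → ℂ) (hT : DifferentiableOn ℂ T D)
    (hdir : ∀ z ∈ D, u (z, S z) = 0)
    (hneu : ∀ z ∈ D,
      deriv (fun z' => u (z', S z)) z
        - deriv (fun w' => u (z, w')) (S z) * deriv S z = -T z / (2 * (k : ℂ)))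
    (z₀ : ℂ) (hz₀ : z₀ ∈ D) (w₀ : ℂ) (hw₀ : w₀ ∈ D')
    (ζ₀ : ℂ) (hζ₀ : ζ₀ ∈ D) (hSζ₀ : S ζ₀ = w₀)
    (hseg : segment ℝ ζ₀ z₀ ⊆ D) :
    u (z₀, w₀) =
      -(1 / (4 * (k : ℂ))) *
        segIntegral (fun z => T z * besselKernel lam ((z - z₀) * (S z - w₀))) ζ₀ z₀ := by
  obtain ⟨dK, hK0, hKode⟩ := aux_bessel lam
  set K := besselKernel lam with hKdef
  have dK' : Differentiable ℂ (deriv K) := by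
    have : ContDiff ℂ 2 K := dK.contDiff
    exact (this.iterate_deriv' 1 1).differentiable (by norm_num)
  have hΩ : IsOpen (D ×ˢ D') := hD.prod hD'
  have hu' : ∀ z ∈ D, ∀ w ∈ D', DifferentiableAt ℂ u (z, w) := fun z hz w hw =>
    hu.differentiableAt (hΩ.mem_nhds ⟨hz, hw⟩)
  have hSm : ∀ z ∈ D, S z ∈ D' := fun z hz => hSD ⟨z, hz, rfl⟩
  have hS' : ∀ z ∈ D, HasDerivAt S (deriv S z) z := fun z hz =>
    (hS.differentiableAt (hD.mem_nhds hz)).hasDerivAt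
  set uz : ℂ × ℂ → ℂ := fun x => fderiv ℂ u x ((1 : ℂ), (0 : ℂ)) with huz
  have duz : DifferentiableOn ℂ uz (D ×ˢ D') := aux_diff_partial _ hΩ u hu
  have huz_d : ∀ z ∈ D, ∀ w ∈ D', HasDerivAt (fun z' => u (z', w)) (uz (z, w)) z := by
    intro z hz w hw
    exact (hu' z hz w hw).hasFDerivAt.comp_hasDerivAt z
      ((hasDerivAt_id z).prodMk (hasDerivAt_const z w))
  have hmixed : ∀ z ∈ D, ∀ w ∈ D',
      HasDerivAt (fun w' => uz (z, w')) (-((lam : ℂ) ^ 2 / 4) * u (z, w)) w := by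
    intro z hz w hw
    have h1 : HasDerivAt (fun w' => uz (z, w')) (fderiv ℂ uz (z, w) (0, 1)) w :=
      (duz.differentiableAt (hΩ.mem_nhds ⟨hz, hw⟩)).hasFDerivAt.comp_hasDerivAt w
        ((hasDerivAt_const w z).prodMk (hasDerivAt_id w))
    have h2 : (fun w' => deriv (fun z' => u (z', w')) z) =ᶠ[nhds w] fun w' => uz (z, w') := by
      filter_upwards [hD'.mem_nhds hw] with w' hw' using (huz_d z hz w' hw').deriv
    have h3 := hhelm z hz w hw
    rw [h2.deriv_eq] at h3
    have h4 : deriv (fun w' => uz (z, w')) w = -((lam : ℂ) ^ 2 / 4) * u (z, w) := by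
      linear_combination h3
    rw [← h4]
    exact h1.differentiableAt.hasDerivAt
  -- on the curve, `u_z = -T/(4k)`
  have hcurve : ∀ z ∈ D, uz (z, S z) = -(1 / (4 * (k : ℂ))) * T z := by
    intro z hz
    have h1 := hneu z hz
    rw [(huz_d z hz _ (hSm z hz)).deriv] at h1
    have hw : HasDerivAt (fun w' => u (z, w')) (fderiv ℂ u (z, S z) (0, 1)) (S z) :=
      (hu' z hz _ (hSm z hz)).hasFDerivAt.comp_hasDerivAt (S z)
        ((hasDerivAt_const (S z) z).prodMk (hasDerivAt_id (S z)))
    rw [hw.deriv] at h1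
    have h2 : HasDerivAt (fun z' => u (z', S z')) (fderiv ℂ u (z, S z) (1, deriv S z)) z :=
      (hu' z hz _ (hSm z hz)).hasFDerivAt.comp_hasDerivAt z
        ((hasDerivAt_id z).prodMk (hS' z hz))
    have h3 : (fun z' => u (z', S z')) =ᶠ[nhds z] fun _ => 0 := by
      filter_upwards [hD.mem_nhds hz] with z' hz' using hdir z' hz'
    have h4 := h2.deriv
    rw [h3.deriv_eq, deriv_const] at h4
    have h5 : ((1 : ℂ), deriv S z) = ((1 : ℂ), (0 : ℂ)) + deriv S z • ((0 : ℂ), (1 : ℂ)) := by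
      simp
    rw [h5, map_add, map_smul, smul_eq_mul] at h4
    have h6 : fderiv ℂ u (z, S z) ((1 : ℂ), (0 : ℂ)) = uz (z, S z) := rfl
    rw [h6] at h4
    have hk' : (k : ℂ) ≠ 0 := by exact_mod_cast hk.ne'
    field_simp at h1 ⊢
    linear_combination (1 : ℂ) * h1 - 2 * (k : ℂ) * h4
  -- a convex neighbourhood of the segment
  have hcomp : IsCompact (segment ℝ ζ₀ z₀) := by
    rw [segment_eq_image_lineMap]
    exact isCompact_Icc.image AffineMap.lineMap_continuous
  obtain ⟨δ, hδ, hVD⟩ := hcomp.exists_thickening_subset_open hD hseg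
  set V := Metric.thickening δ (segment ℝ ζ₀ z₀) with hVdef
  have hVo : IsOpen V := Metric.isOpen_thickening
  have hVc : Convex ℝ V := (convex_segment ζ₀ z₀).thickening δ
  have hsV : segment ℝ ζ₀ z₀ ⊆ V := Metric.self_subset_thickening hδ _
  have hzV : z₀ ∈ V := hsV (right_mem_segment ℝ ζ₀ z₀)
  have hζV : ζ₀ ∈ V := hsV (left_mem_segment ℝ ζ₀ z₀)
  have dS' : DifferentiableOn ℂ (deriv S) D := hS.deriv hD
  have dSsnd : ∀ x ∈ V ×ˢ V, DifferentiableAt ℂ (fun x : ℂ × ℂ => S x.2) x := fun x hx =>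
    (hS' x.2 (hVD hx.2)).differentiableAt.comp (f := fun x : ℂ × ℂ => x.2) x differentiableAt_snd
  have dS'snd : ∀ x ∈ V ×ˢ V, DifferentiableAt ℂ (fun x : ℂ × ℂ => deriv S x.2) x := fun x hx =>
    (dS'.differentiableAt (hD.mem_nhds (hVD hx.2))).comp (f := fun x : ℂ × ℂ => x.2) x
      differentiableAt_snd
  have dmap : ∀ x ∈ V ×ˢ V, DifferentiableAt ℂ (fun x : ℂ × ℂ => (x.1, S x.2)) x := fun x hx =>
    differentiableAt_fst.prodMk (dSsnd x hx)
  have darg : ∀ x ∈ V ×ˢ V,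
      DifferentiableAt ℂ (fun x : ℂ × ℂ => (x.1 - z₀) * (S x.2 - w₀)) x := fun x hx =>
    (differentiableAt_fst.sub_const z₀).mul ((dSsnd x hx).sub_const w₀)
  set a : ℂ × ℂ → ℂ := fun x => K ((x.1 - z₀) * (S x.2 - w₀)) * uz (x.1, S x.2) with ha
  set b : ℂ × ℂ → ℂ := fun x => u (x.1, S x.2) *
    (deriv K ((x.1 - z₀) * (S x.2 - w₀)) * ((x.1 - z₀) * deriv S x.2)) with hb
  have da : DifferentiableOn ℂ a (V ×ˢ V) := by
    intro x hx
    apply DifferentiableAt.differentiableWithinAt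
    refine DifferentiableAt.mul ((dK _).comp x (darg x hx)) ?_
    have hx2 : (x.1, S x.2) ∈ D ×ˢ D' := ⟨hVD hx.1, hSm _ (hVD hx.2)⟩
    exact (duz.differentiableAt (hΩ.mem_nhds hx2)).comp
      (f := fun x : ℂ × ℂ => (x.1, S x.2)) x (dmap x hx)
  have db : DifferentiableOn ℂ b (V ×ˢ V) := by
    intro x hx
    apply DifferentiableAt.differentiableWithinAt
    refine DifferentiableAt.mul ?_ (DifferentiableAt.mul ((dK' _).comp x (darg x hx)) ?_)
    · exact (hu' _ (hVD hx.1) _ (hSm _ (hVD hx.2))).comp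
        (f := fun x : ℂ × ℂ => (x.1, S x.2)) x (dmap x hx)
    · exact (differentiableAt_fst.sub_const z₀).mul (dS'snd x hx)
  have hab : ∀ z ∈ V, ∀ ζ ∈ V,
      deriv (fun ζ' => a (z, ζ')) ζ = deriv (fun z' => b (z', ζ)) z := by
    intro z hz ζ hζ
    have hz' := hVD hz
    have hζ' := hVD hζ
    set s := S ζ - w₀ with hs
    have h1 : HasDerivAt (fun ζ' => K ((z - z₀) * (S ζ' - w₀)))
        (deriv K ((z - z₀) * s) * ((z - z₀) * deriv S ζ)) ζ :=
      (dK _).hasDerivAt.comp ζ (((hS' ζ hζ').sub_const w₀).const_mul (z - z₀))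
    have h2 : HasDerivAt (fun ζ' => uz (z, S ζ'))
        (-((lam : ℂ) ^ 2 / 4) * u (z, S ζ) * deriv S ζ) ζ :=
      HasDerivAt.comp (h₂ := fun w' => uz (z, w')) ζ (hmixed z hz' _ (hSm ζ hζ')) (hS' ζ hζ')
    have h3 : HasDerivAt (fun ζ' => a (z, ζ')) _ ζ := h1.mul h2
    have hlin : HasDerivAt (fun z' : ℂ => z' - z₀) 1 z := (hasDerivAt_id z).sub_const z₀
    have h4 : HasDerivAt (fun z' => deriv K ((z' - z₀) * s))
        (deriv (deriv K) ((z - z₀) * s) * (1 * s)) z :=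
      HasDerivAt.comp (h₂ := deriv K) z (dK' _).hasDerivAt (hlin.mul_const s)
    have h5 : HasDerivAt (fun z' => b (z', ζ)) _ z :=
      (huz_d z hz' _ (hSm ζ hζ')).mul (h4.mul (hlin.mul_const (deriv S ζ)))
    rw [h3.deriv, h5.deriv]
    have h6 := hKode ((z - z₀) * s)
    simp only [← hs]
    linear_combination (-(u (z, S ζ) * deriv S ζ)) * h6
  obtain ⟨P, hP⟩ := aux_primitive V hVo hVc a b da db hab
  have hpre : IsPreconnected V := hVc.isPreconnected
  -- horizontal side
  have hhor : P (z₀, ζ₀) - u (z₀, w₀) = P (ζ₀, ζ₀) - u (ζ₀, w₀) := by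
    have hd : ∀ z ∈ V, HasDerivAt (fun z => P (z, ζ₀) - u (z, w₀)) 0 z := by
      intro z hz
      have h1 : HasDerivAt (fun z => P (z, ζ₀)) _ z := (hP (z, ζ₀) ⟨hz, hζV⟩).comp_hasDerivAt z
        ((hasDerivAt_id z).prodMk (hasDerivAt_const z ζ₀))
      have h2 : HasDerivAt (fun z => P (z, ζ₀) - u (z, w₀)) _ z :=
        h1.sub (huz_d z (hVD hz) w₀ hw₀)
      convert h2 using 1
      simp [ha, hSζ₀, hK0]
    exact hVo.is_const_of_deriv_eq_zero hpre
      (fun z hz => (hd z hz).differentiableAt.differentiableWithinAt)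
      (fun z hz => (hd z hz).deriv) hzV hζV
  have hver : P (z₀, z₀) = P (z₀, ζ₀) := by
    have hd : ∀ z ∈ V, HasDerivAt (fun z => P (z₀, z)) 0 z := by
      intro z hz
      have h1 : HasDerivAt (fun z => P (z₀, z)) _ z := (hP (z₀, z) ⟨hzV, hz⟩).comp_hasDerivAt z
        ((hasDerivAt_const z z₀).prodMk (hasDerivAt_id z))
      convert h1 using 1
      simp [hb]
    exact hVo.is_const_of_deriv_eq_zero hpre
      (fun z hz => (hd z hz).differentiableAt.differentiableWithinAt)
      (fun z hz => (hd z hz).deriv) hzV hζV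
  set f : ℂ → ℂ := fun z => T z * K ((z - z₀) * (S z - w₀)) with hf
  have hdiag : ∀ z ∈ V, HasDerivAt (fun z => P (z, z)) (-(1 / (4 * (k : ℂ))) * f z) z := by
    intro z hz
    have h1 : HasDerivAt (fun z => P (z, z)) _ z := HasFDerivAt.comp_hasDerivAt (f := fun z : ℂ => (z, z)) z
      (hP (z, z) ⟨hz, hz⟩)
      ((hasDerivAt_id z).prodMk (hasDerivAt_id z))
    convert h1 using 1
    simp [ha, hb, hf, hdir z (hVD hz), hcurve z (hVD hz)]
    ring
  have hfc : ContinuousOn f V := by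
    refine ((hT.mono hVD).continuousOn).mul (dK.continuous.comp_continuousOn ?_)
    exact (continuousOn_id.sub continuousOn_const).mul
      ((hS.mono hVD).continuousOn.sub continuousOn_const)
  have hγ : ∀ t ∈ Set.uIcc (0 : ℝ) 1, ζ₀ + (t : ℂ) * (z₀ - ζ₀) ∈ V := by
    intro t ht
    rw [Set.uIcc_of_le zero_le_one] at ht
    apply hsV
    rw [segment_eq_image']
    exact ⟨t, ht, by simp⟩
  have hftc : ∫ t in (0 : ℝ)..1,
      (-(1 / (4 * (k : ℂ))) * f (ζ₀ + (t : ℂ) * (z₀ - ζ₀))) * (z₀ - ζ₀)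
      = P (z₀, z₀) - P (ζ₀, ζ₀) := by
    have h := intervalIntegral.integral_eq_sub_of_hasDerivAt (a := 0) (b := 1)
      (f := fun t : ℝ => P (ζ₀ + (t : ℂ) * (z₀ - ζ₀), ζ₀ + (t : ℂ) * (z₀ - ζ₀)))
      (f' := fun t : ℝ => (-(1 / (4 * (k : ℂ))) * f (ζ₀ + (t : ℂ) * (z₀ - ζ₀))) * (z₀ - ζ₀))
      (fun t ht => by
        have hl : HasDerivAt (fun t : ℝ => ζ₀ + (t : ℂ) * (z₀ - ζ₀)) (z₀ - ζ₀) t := by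
          have := ((Complex.ofRealCLM.hasDerivAt (x := t)).mul_const (z₀ - ζ₀)).const_add ζ₀
          simpa using this
        exact HasDerivAt.comp (h₂ := fun z => P (z, z)) t (hdiag _ (hγ t ht)) hl)
      (by
        apply ContinuousOn.intervalIntegrable
        refine ContinuousOn.mul (continuousOn_const.mul ?_) continuousOn_const
        refine hfc.comp (f := fun t : ℝ => ζ₀ + (t : ℂ) * (z₀ - ζ₀)) ?_ hγ
        fun_prop)
    rw [h]
    simp
  rw [intervalIntegral.integral_mul_const, intervalIntegral.integral_const_mul] at hftc
  have hu0 : u (ζ₀, w₀) = 0 := by rw [← hSζ₀]; exact hdir ζ₀ hζ₀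
  rw [segIntegral]
  linear_combination -hftc - hhor - hver + hu0
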